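/- There exists a positive integer N such that for all n ≥ N, the number of permutations of length n avoiding the pattern 12453 is larger than 14.12^n. -/

import Mathlib

/-- A permutation `p` of length `n` contains the pattern `q` of length `k`:
there are positions `f 0 < f 1 < … < f (k-1)` whose values are order-isomorphic to `q`. -/
def PermContains {n k : ℕ} (p : Equiv.Perm (Fin n)) (q : Equiv.Perm (Fin k)) : Prop :=
  ∃ f : Fin k → Fin n, StrictMono f ∧ ∀ a b : Fin k, p (f a) < p (f b) ↔ q a < q b

/-- `p` avoids the pattern `q`. -/
def PermAvoids {n k : ℕ} (p : Equiv.Perm (Fin n)) (q : Equiv.Perm (Fin k)) : Prop :=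
  ¬ PermContains p q

/-- `avoiders n q` is `S_n(q)`, the number of permutations of length `n` avoiding `q`. -/
noncomputable def avoiders (n : ℕ) {k : ℕ} (q : Equiv.Perm (Fin k)) : ℕ :=
  Nat.card {p : Equiv.Perm (Fin n) // PermAvoids p q}

/-- The pattern 12453 (0-indexed: 0,1,3,4,2). -/
def pat12453 : Equiv.Perm (Fin 5) :=
  ⟨![0, 1, 3, 4, 2], ![0, 1, 4, 2, 3], by decide, by decide⟩

open scoped List ENNReal

/-- No four entries of `l` form the pattern 4213. -/
def Avoids4213 (l : List ℕ) : Prop :=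
  ∀ a b c d, [a, b, c, d] <+ l → c < b → b < d → a ≤ d

theorem Avoids4213.map {l : List ℕ} (h : Avoids4213 l) {f : ℕ → ℕ} (hf : StrictMono f) :
    Avoids4213 (l.map f) := by
  intro a b c d hs
  obtain ⟨m, hm, he⟩ := List.sublist_map_iff.1 hs
  match m, he with
  | [a', b', c', d'], he =>
    simp only [List.map_cons, List.map_nil, List.cons.injEq, and_true] at he
    obtain ⟨rfl, rfl, rfl, rfl⟩ := he
    intro h1 h2
    exact hf.monotone (h _ _ _ _ hm (hf.lt_iff_lt.1 h1) (hf.lt_iff_lt.1 h2))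

/-- `l` is a 4213-avoiding arrangement of `0, …, |l| - 1` whose entries below `j` occur in
increasing order, and the first position at which everything placed so far is an initial segment
containing `0, …, j - 1` is the end of `l`. -/
structure RunList (j : ℕ) (l : List ℕ) : Prop where
  nodup : l.Nodup
  mem_iff : ∀ y, y ∈ l ↔ y < l.length
  le_length : j ≤ l.length
  run : ∀ a b, [a, b] <+ l → a < j → b < j → a < b
  avoids : Avoids4213 l
  indec : ∀ s t, l = s ++ t → t ≠ [] → (∀ x ∈ t, j ≤ x) → ∃ y ∈ s, ∃ x ∈ t, x < y

/-- A `RunList` whose first entry is not one of `0, …, j - 1`. -/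
structure NewList (j : ℕ) (l : List ℕ) : Prop extends RunList j l where
  head : ∀ h t, l = h :: t → j ≤ h

theorem pair_sublist_append {a b : ℕ} {s t : List ℕ} (ha : a ∈ s) (hb : b ∈ t) :
    [a, b] <+ s ++ t :=
  (List.singleton_sublist.2 ha).append (List.singleton_sublist.2 hb)

theorem runList_nil : RunList 0 [] where
  nodup := List.nodup_nil
  mem_iff := by simp
  le_length := le_rfl
  run := by simp
  avoids := by intro a b c d h; simp at h
  indec := by simp

theorem RunList.cons_zero {j : ℕ} {l : List ℕ} (h : RunList j l) :
    RunList (j + 1) (0 :: l.map (· + 1)) where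
  nodup := by
    rw [List.nodup_cons]
    exact ⟨by simp, h.nodup.map (add_left_injective 1)⟩
  mem_iff := by
    intro y
    cases y <;> simp [h.mem_iff]
  le_length := by simpa using h.le_length
  run := by
    intro a b hs ha hb
    rw [List.sublist_cons_iff] at hs
    rcases hs with hs | ⟨r, hr, hs⟩
    · obtain ⟨m, hm, he⟩ := List.sublist_map_iff.1 hs
      match m, he with
      | [a', b'], he =>
        simp only [List.map_cons, List.map_nil, List.cons.injEq, and_true] at he
        obtain ⟨rfl, rfl⟩ := he
        have := h.run _ _ hm (by omega) (by omega)
        omega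
    · obtain ⟨rfl, rfl⟩ := List.cons_eq_cons.1 hr
      simp only [List.singleton_sublist, List.mem_map] at hs
      obtain ⟨c, -, rfl⟩ := hs
      omega
  avoids := by
    intro a b c d hs
    rw [List.sublist_cons_iff] at hs
    rcases hs with hs | ⟨r, hr, hs⟩
    · exact h.avoids.map (f := (· + 1)) (fun _ _ h => by simpa using h) a b c d hs
    · obtain ⟨rfl, rfl⟩ := List.cons_eq_cons.1 hr
      omega
  indec := by
    intro s t he ht hx
    cases s with
    | nil =>
      have := hx 0 (by simp at he; simp [← he])
      omega
    | cons z s =>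
      obtain ⟨rfl, hl⟩ := List.cons_eq_cons.1 he
      obtain ⟨s', t', rfl, rfl, rfl⟩ := List.map_eq_append_iff.1 hl
      obtain ⟨y, hy, x, hx', hlt⟩ := h.indec s' t' rfl (by simpa using ht)
        (fun x hx' => by have := hx (x + 1) (List.mem_map_of_mem hx'); omega)
      exact ⟨y + 1, by simp [hy], x + 1, by simp [hx'], by omega⟩

theorem NewList.of_succ {j : ℕ} {l : List ℕ} (hj : 0 < j) (h : NewList (j + 1) l) :
    NewList j l where
  nodup := h.nodup
  mem_iff := h.mem_iff
  le_length := (Nat.le_succ j).trans h.le_length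
  run a b hs ha hb := h.run a b hs (by omega) (by omega)
  avoids := h.avoids
  indec := by
    intro s t he ht hx
    by_cases hjt : j ∈ t
    · cases s with
      | nil =>
        have h0 := (h.mem_iff 0).2 (by have := h.le_length; omega)
        rw [he] at h0
        have := hx 0 (by simpa using h0)
        omega
      | cons z s =>
        exact ⟨z, by simp, j, hjt, h.head z (s ++ t) (by simpa using he)⟩
    · exact h.indec s t he ht (fun x hxt => by
        have := hx x hxt
        have : x ≠ j := fun e => hjt (e ▸ hxt)
        omega)
  head a t he := (Nat.le_succ j).trans (h.head a t he)

/-- Shift the values from `i` on upwards by `k`. -/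
def bump (i k v : ℕ) : ℕ := if v < i then v else v + k

theorem bump_strictMono (i k : ℕ) : StrictMono (bump i k) := by
  intro a b h
  unfold bump
  split_ifs <;> omega

theorem RunList.cons_bump {j : ℕ} {l : List ℕ} (hj : 0 < j) (h : RunList j l) :
    NewList j (j :: l.map (bump j 1)) := by
  have hrun : ∀ a b, [a, b] <+ j :: l.map (bump j 1) → a < j → b < j → a < b := by
    intro a b hs ha hb
    rw [List.sublist_cons_iff] at hs
    rcases hs with hs | ⟨r, hr, hs⟩
    · obtain ⟨m, hm, he⟩ := List.sublist_map_iff.1 hs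
      match m, he with
      | [a', b'], he =>
        simp only [List.map_cons, List.map_nil, List.cons.injEq, and_true] at he
        obtain ⟨rfl, rfl⟩ := he
        have := h.run a' b' hm (by unfold bump at ha; split_ifs at ha <;> omega)
          (by unfold bump at hb; split_ifs at hb <;> omega)
        exact bump_strictMono j 1 this
    · obtain ⟨rfl, rfl⟩ := List.cons_eq_cons.1 hr
      omega
  refine { nodup := ?_, mem_iff := ?_, le_length := ?_, run := hrun, avoids := ?_,
           indec := ?_, head := ?_ }
  · rw [List.nodup_cons]
    refine ⟨?_, h.nodup.map (bump_strictMono j 1).injective⟩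
    simp only [List.mem_map, not_exists, not_and, bump]
    intro v _
    split_ifs <;> omega
  · intro y
    have hl := h.le_length
    simp only [List.mem_cons, List.mem_map, List.length_cons, List.length_map, h.mem_iff, bump]
    constructor
    · rintro (rfl | ⟨v, hv, rfl⟩)
      · omega
      · split_ifs <;> omega
    · intro hy
      rcases lt_trichotomy y j with hlt | rfl | hgt
      · exact Or.inr ⟨y, by omega, if_pos hlt⟩
      · exact Or.inl rfl
      · exact Or.inr ⟨y - 1, by omega, by rw [if_neg (by omega)]; omega⟩
  · have := h.le_length
    simp only [List.length_cons, List.length_map]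
    omega
  · intro a b c d hs hcb hbd
    by_contra! hda
    have hs' := hs
    rw [List.sublist_cons_iff] at hs
    rcases hs with hs | ⟨r, hr, hs⟩
    · exact absurd (h.avoids.map (bump_strictMono j 1) a b c d hs hcb hbd) (by omega)
    · obtain ⟨rfl, rfl⟩ := List.cons_eq_cons.1 hr
      have := hrun b c (List.Sublist.trans (by simp) hs') (by omega) (by omega)
      omega
  · intro s t he ht hx
    cases s with
    | nil =>
      have h0 := (h.mem_iff 0).2 (by have := h.le_length; omega)
      have := hx 0 (by
        rw [List.nil_append] at he
        rw [← he]
        exact List.mem_cons_of_mem _ (List.mem_map.2 ⟨0, h0, if_pos hj⟩))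
      omega
    | cons z s =>
      obtain ⟨rfl, hl⟩ := List.cons_eq_cons.1 he
      obtain ⟨s', t', rfl, rfl, rfl⟩ := List.map_eq_append_iff.1 hl
      obtain ⟨y, hy, x, hx', hlt⟩ := h.indec s' t' rfl (by simpa using ht)
        (fun x hx' => by
          have := hx _ (List.mem_map_of_mem hx')
          unfold bump at this
          split_ifs at this <;> omega)
      exact ⟨_, List.mem_cons_of_mem _ (List.mem_map_of_mem hy), _, List.mem_map_of_mem hx',
        bump_strictMono _ 1 hlt⟩
  · intro a t he
    exact (List.cons_eq_cons.1 he).1.le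

/-- Follow `s`, with `k` values inserted at `i`, by `t`, whose values below `k` fill the gap. -/
def glue (i k : ℕ) (s t : List ℕ) : List ℕ :=
  s.map (bump i k) ++ t.map fun v => bump k (s.length - i) v + i

theorem mem_glue_left {i k y : ℕ} {s : List ℕ} (hs : RunList (i + 1) s)
    (hy : y ∈ s.map (bump i k)) : y < i ∨ i + k ≤ y ∧ y < s.length + k := by
  obtain ⟨v, hv, rfl⟩ := List.mem_map.1 hy
  have := (hs.mem_iff v).1 hv
  unfold bump
  split_ifs <;> omega

theorem mem_glue_right {i k y : ℕ} {s t : List ℕ} (hs : RunList (i + 1) s)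
    (hy : y ∈ t.map fun v => bump k (s.length - i) v + i) :
    i ≤ y ∧ y < i + k ∨ s.length + k ≤ y := by
  obtain ⟨v, hv, rfl⟩ := List.mem_map.1 hy
  have := hs.le_length
  simp only [bump]
  split_ifs <;> omega

theorem NewList.glue {i k : ℕ} (hk : 0 < k) {s t : List ℕ} (hs : NewList (i + 1) s)
    (ht : RunList k t) : NewList (i + k) (glue i k s t) := by
  have hsl := hs.le_length
  have htl := ht.le_length
  have hmono1 := bump_strictMono i k
  have hmono2 : StrictMono fun v => bump k (s.length - i) v + i := fun a b h =>
    Nat.add_lt_add_right (bump_strictMono _ _ h) i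
  have hmem1 : ∀ y, y ∈ s.map (bump i k) ↔ y < i ∨ i + k ≤ y ∧ y < s.length + k := by
    refine fun y => ⟨mem_glue_left hs.toRunList, fun h => List.mem_map.2 ?_⟩
    rcases h with h | h
    · exact ⟨y, (hs.mem_iff y).2 (by omega), if_pos h⟩
    · exact ⟨y - k, (hs.mem_iff _).2 (by omega), by rw [bump, if_neg (by omega)]; omega⟩
  have hmem2 : ∀ y, (y ∈ t.map fun v => bump k (s.length - i) v + i) ↔
      i ≤ y ∧ y < i + k ∨ s.length + k ≤ y ∧ y < s.length + t.length := by
    intro y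
    constructor
    · intro hy
      obtain ⟨v, hv, rfl⟩ := List.mem_map.1 hy
      have := (ht.mem_iff v).1 hv
      simp only [bump]
      split_ifs <;> omega
    · intro h
      rcases h with h | h
      · exact List.mem_map.2 ⟨y - i, (ht.mem_iff _).2 (by omega),
          by simp only [bump]; rw [if_pos (by omega)]; omega⟩
      · exact List.mem_map.2 ⟨y - s.length, (ht.mem_iff _).2 (by omega),
          by simp only [bump]; rw [if_neg (by omega)]; omega⟩
  have hrun : ∀ a b, [a, b] <+ _root_.glue i k s t → a < i + k → b < i + k → a < b := by
    intro a b hab ha hb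
    obtain ⟨l₁, l₂, he, h1, h2⟩ := List.sublist_append_iff.1 hab
    rcases l₁ with _ | ⟨a', _ | ⟨b', _ | ⟨c', l₁⟩⟩⟩
    · simp only [List.nil_append] at he
      subst he
      obtain ⟨m, hm, he⟩ := List.sublist_map_iff.1 h2
      match m, he with
      | [a', b'], he =>
        simp only [List.map_cons, List.map_nil, List.cons.injEq, and_true] at he
        obtain ⟨rfl, rfl⟩ := he
        refine hmono2 (ht.run a' b' hm ?_ ?_)
        · simp only [bump] at ha
          split_ifs at ha <;> omega
        · simp only [bump] at hb
          split_ifs at hb <;> omega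
    · simp only [List.cons_append, List.nil_append, List.cons.injEq] at he
      obtain ⟨rfl, rfl⟩ := he
      have := (hmem1 a).1 (by simpa using h1)
      have := (hmem2 b).1 (by simpa using h2)
      omega
    · simp only [List.cons_append, List.nil_append, List.cons.injEq] at he
      obtain ⟨rfl, rfl, rfl⟩ := he
      obtain ⟨m, hm, he⟩ := List.sublist_map_iff.1 h1
      match m, he with
      | [a', b'], he =>
        simp only [List.map_cons, List.map_nil, List.cons.injEq, and_true] at he
        obtain ⟨rfl, rfl⟩ := he
        refine hmono1 (hs.run a' b' hm ?_ ?_)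
        · simp only [bump] at ha
          split_ifs at ha <;> omega
        · simp only [bump] at hb
          split_ifs at hb <;> omega
    · simp at he
  refine { nodup := ?_, mem_iff := ?_, le_length := ?_, run := hrun, avoids := ?_,
           indec := ?_, head := ?_ }
  · refine List.nodup_append.2 ⟨hs.nodup.map hmono1.injective, ht.nodup.map hmono2.injective, ?_⟩
    rintro a ha b hb rfl
    have := (hmem1 a).1 ha
    have := (hmem2 a).1 hb
    omega
  · intro y
    rw [_root_.glue, List.mem_append, hmem1, hmem2, List.length_append, List.length_map,
      List.length_map]
    omega
  · simp only [_root_.glue, List.length_append, List.length_map]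
    omega
  · intro a b c d habcd hcb hbd
    by_contra! hda
    have hbc : [b, c] <+ _root_.glue i k s t := List.Sublist.trans (by simp) habcd
    obtain ⟨l₁, l₂, he, h1, h2⟩ := List.sublist_append_iff.1 habcd
    rcases List.eq_nil_or_concat l₂ with rfl | ⟨l₂, d', rfl⟩
    · rw [List.append_nil] at he
      subst he
      exact absurd (hs.avoids.map hmono1 a b c d h1 hcb hbd) (by omega)
    · rcases l₁ with _ | ⟨a', l₁⟩
      · rw [List.nil_append] at he
        rw [← he] at h2
        exact absurd (ht.avoids.map hmono2 a b c d h2 hcb hbd) (by omega)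
      · have ha : a ∈ s.map (bump i k) := by
          obtain ⟨rfl, -⟩ := List.cons_eq_cons.1 he
          exact h1.subset (by simp)
        have hd : d ∈ t.map fun v => bump k (s.length - i) v + i := by
          have : [a, b, c] ++ [d] = (a' :: l₁ ++ l₂) ++ [d'] := by simpa using he
          have : d = d' := by simpa using (List.append_inj' this rfl).2
          exact h2.subset (by simp [this])
        have := (hmem1 a).1 ha
        have := (hmem2 d).1 hd
        have := hrun b c hbc (by omega) (by omega)
        omega
  · intro u w he hw hx
    rcases List.append_eq_append_iff.1 he with ⟨r, rfl, hr⟩ | ⟨r, hr, rfl⟩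
    · obtain ⟨u', w', rfl, rfl, rfl⟩ := List.map_eq_append_iff.1 hr
      obtain ⟨y, hy, x, hx', hlt⟩ := ht.indec u' w' rfl (by simpa using hw) (by
        intro x hx'
        have := hx _ (List.mem_map_of_mem hx')
        simp only [bump] at this
        split_ifs at this <;> omega)
      exact ⟨_, List.mem_append_right _ (List.mem_map_of_mem hy), _, List.mem_map_of_mem hx',
        hmono2 hlt⟩
    · have := hx i (List.mem_append_right _ ((hmem2 i).2 (by omega)))
      omega
  · intro a r he
    cases s with
    | nil => simp at hsl
    | cons z s =>
      rw [_root_.glue, List.map_cons, List.cons_append] at he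
      obtain ⟨rfl, -⟩ := List.cons_eq_cons.1 he
      have := hs.head z s rfl
      unfold bump
      split_ifs <;> omega

theorem glue_length_le {j i k i' k' : ℕ} (hj : i + k = j) (hj' : i' + k' = j)
    {s t s' t' : List ℕ} (hs : NewList (i + 1) s) (hs' : NewList (i' + 1) s')
    (he : glue i k s t = glue i' k' s' t') : s'.length ≤ s.length := by
  by_contra! hlt
  have hsl := hs.le_length
  have hsl' := hs'.le_length
  rcases List.append_eq_append_iff.1 he with ⟨r, hr, hr'⟩ | ⟨r, hr, -⟩
  · obtain ⟨u, w, rfl, hu, rfl⟩ := List.map_eq_append_iff.1 hr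
    have hw : w ≠ [] := by
      rintro rfl
      have := congrArg List.length hu
      simp at this hlt
      omega
    have hright : ∀ x ∈ w, i ≤ bump i' k' x ∧ bump i' k' x < i + k ∨
        s.length + k ≤ bump i' k' x := by
      intro x hx
      exact mem_glue_right hs.toRunList (t := t)
        (hr' ▸ List.mem_append_left _ (List.mem_map_of_mem hx))
    have hju : i' ∈ u := by
      have : j ∈ u.map (bump i' k') := by
        rw [hu]
        exact List.mem_map.2 ⟨i, (hs.mem_iff i).2 (by omega), by rw [bump, if_neg (by omega), hj]⟩
      obtain ⟨v, hv, hvj⟩ := List.mem_map.1 this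
      have : v = i' := by
        unfold bump at hvj
        split_ifs at hvj <;> omega
      exact this ▸ hv
    have hwi : ∀ x ∈ w, i' + 1 ≤ x := by
      intro x hx
      by_contra! hxi
      have := hs'.run i' x (pair_sublist_append hju hx) (by omega) (by omega)
      omega
    obtain ⟨y, hy, x, hx, hxy⟩ := hs'.indec u w rfl hw hwi
    have h1 := hright x hx
    have h2 := mem_glue_left (k := k) hs.toRunList (hu ▸ List.mem_map_of_mem hy)
    have h3 := hwi x hx
    have h4 := bump_strictMono i' k' hxy
    have h5 : j ≤ bump i' k' x := by rw [bump, if_neg (by omega)]; omega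
    omega
  · have := congrArg List.length hr
    simp at this
    omega

theorem glue_injective {j i k i' k' : ℕ} (hj : i + k = j) (hj' : i' + k' = j)
    {s t s' t' : List ℕ} (hs : NewList (i + 1) s) (hs' : NewList (i' + 1) s')
    (he : glue i k s t = glue i' k' s' t') : i = i' ∧ s = s' ∧ t = t' := by
  have hl : s.length = s'.length :=
    le_antisymm (glue_length_le hj' hj hs' hs he.symm) (glue_length_le hj hj' hs hs' he)
  obtain ⟨h1, h2⟩ := List.append_inj he (by simpa using hl)
  have key : ∀ {i k i' k' : ℕ} {s s' : List ℕ}, i + k = j → i' + k' = j → NewList (i + 1) s →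
      NewList (i' + 1) s' → s.map (bump i k) = s'.map (bump i' k') → i' ≤ i := by
    intro i k i' k' s s' hj hj' hs hs' h1
    by_contra! hlt
    have hsl' := hs'.le_length
    have : i ∈ s.map (bump i k) := by
      rw [h1]
      exact List.mem_map.2 ⟨i, (hs'.mem_iff i).2 (by omega), if_pos hlt⟩
    have := mem_glue_left hs.toRunList this
    omega
  obtain rfl : i = i' := le_antisymm (key hj' hj hs' hs h1.symm) (key hj hj' hs hs' h1)
  obtain rfl : k = k' := by omega
  refine ⟨rfl, List.map_injective_iff.2 (bump_strictMono i k).injective h1, ?_⟩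
  rw [hl] at h2
  refine List.map_injective_iff.2 ?_ h2
  intro a b hab
  exact (bump_strictMono _ _).injective (Nat.add_right_cancel hab)

/-- Generating function of `RunList j` by the number of entries outside the initial run. -/
noncomputable def runGF (x : ℝ≥0∞) (j : ℕ) : ℝ≥0∞ :=
  ∑' l : {l // RunList j l}, x ^ (l.1.length - j)

/-- Generating function of `NewList j` by the number of entries outside the initial run. -/
noncomputable def newGF (x : ℝ≥0∞) (j : ℕ) : ℝ≥0∞ :=
  ∑' l : {l // NewList j l}, x ^ (l.1.length - j)

theorem tsum_sumType {α β : Type*} (f : α ⊕ β → ℝ≥0∞) :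
    ∑' z, f z = ∑' a, f (Sum.inl a) + ∑' b, f (Sum.inr b) :=
  Summable.tsum_sum ENNReal.summable ENNReal.summable

theorem one_le_runGF_zero (x : ℝ≥0∞) : 1 ≤ runGF x 0 := by
  have := ENNReal.le_tsum (f := fun l : {l // RunList 0 l} => x ^ (l.1.length - 0))
    ⟨[], runList_nil⟩
  simpa [runGF] using this

theorem runGF_add_newGF_le (x : ℝ≥0∞) (j : ℕ) :
    runGF x j + newGF x (j + 1) ≤ runGF x (j + 1) := by
  let f : {l // RunList j l} ⊕ {l // NewList (j + 1) l} → {l // RunList (j + 1) l} :=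
    Sum.elim (fun l => ⟨_, l.2.cons_zero⟩) fun l => ⟨l.1, l.2.toRunList⟩
  have hf : Function.Injective f := by
    rintro (⟨l, hl⟩ | ⟨l, hl⟩) (⟨m, hm⟩ | ⟨m, hm⟩) h
    · simp only [f, Sum.elim_inl, Subtype.mk.injEq, List.cons.injEq, true_and] at h
      simpa using List.map_injective_iff.2 (add_left_injective 1) h
    · simp only [f, Sum.elim_inl, Sum.elim_inr, Subtype.mk.injEq] at h
      have := hm.head _ _ h.symm
      omega
    · simp only [f, Sum.elim_inl, Sum.elim_inr, Subtype.mk.injEq] at h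
      have := hl.head _ _ h
      omega
    · simpa [f] using h
  refine le_trans (le_of_eq ?_) (ENNReal.tsum_comp_le_tsum_of_injective hf
    fun l => x ^ (l.1.length - (j + 1)))
  rw [tsum_sumType]
  simp [f, runGF, newGF]

theorem le_newGF (x : ℝ≥0∞) {j : ℕ} (hj : 0 < j) :
    x * (runGF x j + ∑ i ∈ Finset.range j, newGF x (i + 1) * runGF x (j - i) + newGF x (j + 1))
      ≤ newGF x j := by
  let f : ({l // RunList j l} ⊕ Σ i : Fin j, {l // NewList (i + 1) l} × {l // RunList (j - i) l}) ⊕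
      {l // NewList (j + 1) l} → {l // NewList j l} :=
    Sum.elim (Sum.elim (fun l => ⟨_, l.2.cons_bump hj⟩)
      fun p => ⟨glue p.1 (j - p.1) p.2.1.1 p.2.2.1, by
        have := p.2.1.2.glue (Nat.sub_pos_of_lt p.1.2) p.2.2.2
        rwa [Nat.add_sub_cancel' p.1.2.le] at this⟩)
      fun l => ⟨l.1, l.2.of_succ hj⟩
  have hglue_head : ∀ (i : Fin j) (s t : List ℕ), NewList (i + 1) s →
      ∀ h r, glue i (j - i) s t = h :: r → j + 1 ≤ h := by
    intro i s t hs h r he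
    have := hs.le_length
    cases s with
    | nil => simp at this
    | cons z s =>
      rw [glue, List.map_cons, List.cons_append] at he
      obtain ⟨rfl, -⟩ := List.cons_eq_cons.1 he
      have := hs.head z s rfl
      unfold bump
      split_ifs <;> omega
  have hglue_run : ∀ (i : Fin j) (s t : List ℕ), NewList (i + 1) s → RunList (j - i) t →
      ¬ RunList (j + 1) (glue i (j - i) s t) := by
    intro i s t hs ht h
    have hsl := hs.le_length
    have htl := ht.le_length
    have := i.2
    have h1 : j ∈ s.map (bump i (j - i)) :=
      List.mem_map.2 ⟨i, (hs.mem_iff _).2 (by omega), by rw [bump, if_neg (by omega)]; omega⟩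
    have h2 : (i : ℕ) ∈ t.map fun v => bump (j - i) (s.length - i) v + i :=
      List.mem_map.2 ⟨0, (ht.mem_iff _).2 (by omega), by
        simp only [bump]; rw [if_pos (by omega)]; omega⟩
    have := h.run _ _ (pair_sublist_append h1 h2) (by omega) (by omega)
    omega
  have hf : Function.Injective f := by
    rintro ((⟨l, hl⟩ | ⟨i, ⟨s, hs⟩, ⟨t, ht⟩⟩) | ⟨l, hl⟩)
      ((⟨m, hm⟩ | ⟨i', ⟨s', hs'⟩, ⟨t', ht'⟩⟩) | ⟨m, hm⟩) h <;>
      simp only [f, Sum.elim_inl, Sum.elim_inr, Subtype.mk.injEq] at h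
    · obtain ⟨-, h⟩ := List.cons_eq_cons.1 h
      simpa using List.map_injective_iff.2 (bump_strictMono j 1).injective h
    · have := hglue_head _ _ _ hs' _ _ h.symm
      omega
    · have := hm.head _ _ h.symm
      omega
    · have := hglue_head _ _ _ hs _ _ h
      omega
    · obtain ⟨h1, rfl, rfl⟩ := glue_injective (Nat.add_sub_cancel' i.2.le)
        (Nat.add_sub_cancel' i'.2.le) hs hs' h
      obtain rfl : i = i' := Fin.ext h1
      rfl
    · exact absurd (h ▸ hm.toRunList) (hglue_run _ _ _ hs ht)
    · have := hl.head _ _ h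
      omega
    · exact absurd (h ▸ hl.toRunList) (hglue_run _ _ _ hs' ht')
    · simp [h]
  refine le_trans (le_of_eq ?_) (ENNReal.tsum_comp_le_tsum_of_injective hf
    fun l => x ^ (l.1.length - j))
  rw [tsum_sumType, tsum_sumType, mul_add, mul_add]
  congr 1
  · congr 1
    · rw [runGF, ← ENNReal.tsum_mul_left]
      refine tsum_congr fun l => ?_
      have := l.2.le_length
      simp only [f, Sum.elim_inl, List.length_cons, List.length_map]
      rw [← pow_succ', Nat.sub_add_comm this]
    · rw [ENNReal.tsum_sigma', tsum_fintype (L := .unconditional _), Finset.mul_sum,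
        ← Fin.sum_univ_eq_sum_range (fun i => x * (newGF x (i + 1) * runGF x (j - i)))]
      refine Finset.sum_congr rfl fun i _ => ?_
      rw [ENNReal.tsum_prod', newGF, runGF, ← ENNReal.tsum_mul_right, ← ENNReal.tsum_mul_left]
      refine tsum_congr fun s => ?_
      rw [← ENNReal.tsum_mul_left, ← ENNReal.tsum_mul_left]
      refine tsum_congr fun t => ?_
      have h1 := s.2.le_length
      have h2 := t.2.le_length
      have h3 := i.2
      simp only [f, Sum.elim_inl, Sum.elim_inr, glue, List.length_append, List.length_map]
      rw [← pow_add, ← pow_succ']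
      congr 1
      omega
  · rw [newGF, ← ENNReal.tsum_mul_left]
    refine tsum_congr fun l => ?_
    have := l.2.le_length
    simp only [f, Sum.elim_inr]
    rw [← pow_succ']
    congr 1
    omega

theorem no_monotone_solution {V : ℕ → ℝ} {s : ℝ} (h0 : V 0 = 1 - s)
    (hrec : ∀ m, V (m + 1) =
      61 / 8 * (V m - ∑ i ∈ Finset.range (m + 1), V i * V (m - i)) - s)
    (hpos : ∀ m, 0 < V m) (hmono : ∀ m, V m ≤ V (m + 1)) : False := by
  have h1 := hrec 0
  have h2 := hrec 1
  have h3 := hrec 2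
  have h4 := hrec 3
  have h5 := hrec 4
  have h6 := hrec 5
  have h7 := hrec 6
  simp only [Finset.sum_range_succ, Finset.sum_range_zero, zero_add, Nat.reduceAdd,
    Nat.reduceSub, Nat.sub_zero, Nat.sub_self] at h1 h2 h3 h4 h5 h6 h7
  have hs1 : s < 1 := by linarith [hpos 0]
  have hs0 : 0 < s := by
    by_contra! hs
    have := hpos 1
    rw [h1, h0] at this
    nlinarith
  have e1 : V 1 = 53 / 8 * s + (-61) / 8 * s ^ 2 := by
    rw [h1, h0]
    ring
  have e2 : V 2 = (-3297) / 64 * s + 10187 / 64 * s ^ 2 + (-3721) / 32 * s ^ 3 := by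
    rw [h2, e1, h0]
    ring
  have e3 : V 3 = 200605 / 512 * s + (-597495) / 256 * s ^ 2 + 1045601 / 256 * s ^ 3 +
      (-1134905) / 512 * s ^ 4 := by
    rw [h3, e2, e1, h0]
    ring
  have e4 : V 4 = (-12241001) / 4096 * s + 59343301 / 2048 * s ^ 2 + (-181878759) / 2048 * s ^ 3 +
      448287475 / 4096 * s ^ 4 + (-96920887) / 2048 * s ^ 5 := by
    rw [h4, e3, e2, e1, h0]
    ring
  have e5 : V 5 = 746668293 / 32768 * s + (-10693479523) / 32768 * s ^ 2 + 24993119775 / 16384 * s ^ 3 +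
      (-25865619855) / 8192 * s ^ 4 + 49332731483 / 16384 * s ^ 5 +
      (-17736522321) / 16384 * s ^ 6 := by
    rw [h5, e4, e3, e2, e1, h0]
    ring
  have e6 : V 6 = (-45547028017) / 262144 * s + 903236246685 / 262144 * s ^ 2 +
      (-1485567630615) / 65536 * s ^ 3 + 4538322803585 / 65536 * s ^ 4 +
      (-14193579296715) / 131072 * s ^ 5 + 11049853405983 / 131072 * s ^ 6 +
      (-1700172353913) / 65536 * s ^ 7 := by
    rw [h6, e5, e4, e3, e2, e1, h0]
    ring
  have e7 : V 7 = 2778366611885 / 2097152 * s + (-18215159193039) / 524288 * s ^ 2 +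
      159893275073859 / 524288 * s ^ 3 + (-1339161162773105) / 1048576 * s ^ 4 +
      3030055620645095 / 1048576 * s ^ 5 + (-1904210772904881) / 524288 * s ^ 6 +
      1253027024833881 / 524288 * s ^ 7 + (-1348236676653009) / 2097152 * s ^ 8 := by
    rw [h7, e6, e5, e4, e3, e2, e1, h0]
    ring
  rcases le_or_gt s (19 / 32) with hs | hs
  · have key : V 2 - V 1 = -(59536 / 361 * s * (19 / 32 - s) ^ 2 +
        35319 / 722 * s ^ 2 * (19 / 32 - s) +
        3233 / 11552 * s ^ 3) := by
      rw [e2, e1]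
      ring
    have ha : 0 < s := by linarith
    have hb : 0 ≤ 19 / 32 - s := by linarith
    have : V 2 - V 1 < 0 := by
      rw [key, neg_lt_zero]
      positivity
    linarith [hmono 1]
  rcases le_or_gt s (25 / 32) with hs' | hs'
  · have key : V 4 - V 3 = -(635556770023 / 5308416 * (25 / 32 - s) ^ 5 +
        4725117861001 / 5308416 * (s - 19 / 32) * (25 / 32 - s) ^ 4 +
        1691313823625 / 884736 * (s - 19 / 32) ^ 2 * (25 / 32 - s) ^ 3 +
        3811546692305 / 2654208 * (s - 19 / 32) ^ 3 * (25 / 32 - s) ^ 2 +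
        1341540006259 / 5308416 * (s - 19 / 32) ^ 4 * (25 / 32 - s) +
        9329137175 / 1769472 * (s - 19 / 32) ^ 5) := by
      rw [e4, e3]
      ring
    have ha : 0 < s - 19 / 32 := by linarith
    have hb : 0 ≤ 25 / 32 - s := by linarith
    have : V 4 - V 3 < 0 := by
      rw [key, neg_lt_zero]
      positivity
    linarith [hmono 3]
  rcases le_or_gt s (53 / 64) with hs'' | hs''
  · have key : V 7 - V 6 = -(1514848798549732337425 / 53747712 * (53 / 64 - s) ^ 8 +
        3185862338593952305277 / 13436928 * (s - 25 / 32) * (53 / 64 - s) ^ 7 +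
        42891794138461334032975 / 53747712 * (s - 25 / 32) ^ 2 * (53 / 64 - s) ^ 6 +
        74829295013179339585379 / 53747712 * (s - 25 / 32) ^ 3 * (53 / 64 - s) ^ 5 +
        575285903604646900637315 / 429981696 * (s - 25 / 32) ^ 4 * (53 / 64 - s) ^ 4 +
        145288490097384142942235 / 214990848 * (s - 25 / 32) ^ 5 * (53 / 64 - s) ^ 3 +
        122417997076893336656191 / 859963392 * (s - 25 / 32) ^ 6 * (53 / 64 - s) ^ 2 +
        1593689563763120979221 / 859963392 * (s - 25 / 32) ^ 7 * (53 / 64 - s) +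
        6656342673921501107761 / 13759414272 * (s - 25 / 32) ^ 8) := by
      rw [e7, e6]
      ring
    have ha : 0 < s - 25 / 32 := by linarith
    have hb : 0 ≤ 53 / 64 - s := by linarith
    have : V 7 - V 6 < 0 := by
      rw [key, neg_lt_zero]
      positivity
    linarith [hmono 6]
  · have key : V 7 = -(2142415115879735017009 / 449543156006912 * (1 - s) ^ 8 +
        1553081214849097239013 / 1756027953152 * (s - 53 / 64) * (1 - s) ^ 7 +
        2174333127877125484801 / 27437936768 * (s - 53 / 64) ^ 2 * (1 - s) ^ 6 +
        638220090472370154851 / 857435524 * (s - 53 / 64) ^ 3 * (1 - s) ^ 5 +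
        631347894198934200720 / 214358881 * (s - 53 / 64) ^ 4 * (1 - s) ^ 4 +
        1312976130973446092800 / 214358881 * (s - 53 / 64) ^ 5 * (1 - s) ^ 3 +
        1510941196229534416896 / 214358881 * (s - 53 / 64) ^ 6 * (1 - s) ^ 2 +
        913504610608985669632 / 214358881 * (s - 53 / 64) ^ 7 * (1 - s) +
        227086068777318612992 / 214358881 * (s - 53 / 64) ^ 8) := by
      rw [e7]
      ring
    have ha : 0 < s - 53 / 64 := by linarith
    have hb : 0 ≤ 1 - s := by linarith
    have : V 7 < 0 := by
      rw [key, neg_lt_zero]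
      positivity
    linarith [hpos 7]

/-- The functional whose fixed points are the sequences `j ↦ newGF x (j + 1)`, up to slack. -/
noncomputable def kernelMap (x : ℝ≥0∞) : (ℕ → ℝ≥0∞) →o (ℕ → ℝ≥0∞) where
  toFun e j := x * ((1 + ∑ i ∈ Finset.range (j + 1), e i) +
    ∑ i ∈ Finset.range (j + 1), e i * (1 + ∑ k ∈ Finset.range (j + 1 - i), e k) + e (j + 1))
  monotone' := by
    intro e f h j
    have h' : ∀ i, e i ≤ f i := h
    dsimp only
    gcongr <;> apply h'

theorem kernelMap_apply (x : ℝ≥0∞) (e : ℕ → ℝ≥0∞) (j : ℕ) :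
    kernelMap x e j = x * ((1 + ∑ i ∈ Finset.range (j + 1), e i) +
      ∑ i ∈ Finset.range (j + 1), e i * (1 + ∑ k ∈ Finset.range (j + 1 - i), e k) + e (j + 1)) :=
  rfl

theorem one_add_sum_newGF_le (x : ℝ≥0∞) (j : ℕ) :
    1 + ∑ i ∈ Finset.range j, newGF x (i + 1) ≤ runGF x j := by
  induction j with
  | zero => simpa using one_le_runGF_zero x
  | succ j ih =>
    rw [Finset.sum_range_succ, ← add_assoc]
    exact (add_le_add_left ih _).trans (runGF_add_newGF_le x j)

theorem kernelMap_newGF_le (x : ℝ≥0∞) :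
    kernelMap x (fun j => newGF x (j + 1)) ≤ fun j => newGF x (j + 1) := by
  intro j
  refine le_trans ?_ (le_newGF x j.succ_pos)
  rw [kernelMap_apply]
  gcongr
  · exact one_add_sum_newGF_le x (j + 1)
  · exact one_add_sum_newGF_le x _

theorem no_fixed_sequence {y : ℕ → ℝ} (hy : ∀ j, 0 ≤ y j)
    (h : ∀ j, y j = 8 / 61 * ((1 + ∑ i ∈ Finset.range (j + 1), y i) +
      ∑ i ∈ Finset.range (j + 1), y i * (1 + ∑ k ∈ Finset.range (j + 1 - i), y k) +
      y (j + 1))) : False := by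
  set E : ℕ → ℝ := fun j => 1 + ∑ i ∈ Finset.range j, y i with hE
  have hEs : ∀ j, E (j + 1) = E j + y j := fun j => by
    simp only [hE, Finset.sum_range_succ, add_assoc]
  have hE0 : E 0 = 1 := by simp [hE]
  have hE1 : ∀ j, 1 ≤ E j := fun j => by
    have := Finset.sum_nonneg (s := Finset.range j) fun i _ => hy i
    simp only [hE]
    linarith
  have h' : ∀ j, y j = 8 / 61 * (E (j + 1) +
      ∑ i ∈ Finset.range (j + 1), y i * E (j + 1 - i) + y (j + 1)) := h
  have hrec : ∀ j, 8 / 61 * E (j + 1) = E j - (1 - 8 / 61 * E 1) -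
      8 / 61 * ∑ i ∈ Finset.range j, E (i + 1) * E (j - i) := by
    intro j
    induction j with
    | zero => simp [hE0]
    | succ j ih =>
      have h1 : ∑ i ∈ Finset.range (j + 1), E (i + 1) * E (j + 1 - i) =
          ∑ i ∈ Finset.range (j + 1), E i * E (j + 1 - i) +
          ∑ i ∈ Finset.range (j + 1), y i * E (j + 1 - i) := by
        rw [← Finset.sum_add_distrib]
        refine Finset.sum_congr rfl fun i _ => ?_
        rw [hEs, add_mul]
      rw [Finset.sum_range_succ' (fun i => E i * E (j + 1 - i))] at h1
      simp only [Nat.add_sub_add_right, hE0, Nat.sub_zero, one_mul] at h1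
      rw [h1]
      linear_combination ih + (8 / 61) * hEs (j + 1) - hEs j - h' j
  refine no_monotone_solution (V := fun m => 8 / 61 * E (m + 1)) (s := 1 - 8 / 61 * E 1)
    (by ring) ?_ ?_ ?_
  · intro m
    have h1 : ∑ i ∈ Finset.range (m + 1), 8 / 61 * E (i + 1) * (8 / 61 * E (m - i + 1)) =
        (8 / 61) ^ 2 * ∑ i ∈ Finset.range (m + 1), E (i + 1) * E (m + 1 - i) := by
      rw [Finset.mul_sum]
      refine Finset.sum_congr rfl fun i hi => ?_
      rw [Nat.sub_add_comm (by simpa [Nat.lt_succ_iff] using hi)]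
      ring
    simp only [h1]
    linear_combination hrec (m + 1)
  · intro m
    linarith [hE1 (m + 1)]
  · intro m
    simp only [hEs (m + 1)]
    linarith [hy (m + 1)]

theorem newGF_one_eq_top : newGF (ENNReal.ofReal (8 / 61)) 1 = ⊤ := by
  by_contra htop
  set x := ENNReal.ofReal (8 / 61) with hx
  have hx0 : x ≠ 0 := by simp [hx]
  have hfin : ∀ j, newGF x (j + 1) ≠ ⊤ := by
    intro j
    induction j with
    | zero => exact htop
    | succ j ih =>
      intro h
      refine ih (top_le_iff.1 (le_trans ?_ (le_newGF x j.succ_pos)))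
      rw [h, add_top, ENNReal.mul_top hx0]
  set e := (kernelMap x).lfp with he
  have hle : ∀ j, e j ≤ newGF x (j + 1) := (kernelMap x).lfp_le (kernelMap_newGF_le x)
  have hefin : ∀ j, e j ≠ ⊤ := fun j => ne_top_of_le_ne_top (hfin j) (hle j)
  refine no_fixed_sequence (y := fun j => (e j).toReal) (fun j => ENNReal.toReal_nonneg) ?_
  intro j
  have hfix := congrArg ENNReal.toReal (congrFun (kernelMap x).map_lfp j)
  rw [← he] at hfix
  rw [kernelMap_apply] at hfix
  have hsum : ∀ n, ∑ k ∈ Finset.range n, e k ≠ ⊤ := fun n =>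
    (ENNReal.sum_lt_top.2 fun k _ => (hefin k).lt_top).ne
  have hsum' : ∀ n, 1 + ∑ k ∈ Finset.range n, e k ≠ ⊤ := fun n =>
    ENNReal.add_ne_top.2 ⟨ENNReal.one_ne_top, hsum n⟩
  have hprod : ∀ i n, e i * (1 + ∑ k ∈ Finset.range n, e k) ≠ ⊤ := fun i n =>
    ENNReal.mul_ne_top (hefin i) (hsum' n)
  have hsum2 : ∑ i ∈ Finset.range (j + 1), e i * (1 + ∑ k ∈ Finset.range (j + 1 - i), e k) ≠ ⊤ :=
    (ENNReal.sum_lt_top.2 fun i _ => (hprod i _).lt_top).ne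
  have hone : ∀ n, (1 + ∑ k ∈ Finset.range n, e k).toReal =
      1 + ∑ k ∈ Finset.range n, (e k).toReal := fun n => by
    rw [ENNReal.toReal_add ENNReal.one_ne_top (hsum n), ENNReal.toReal_one,
      ENNReal.toReal_sum fun k _ => hefin k]
  rw [← hfix, ENNReal.toReal_mul, hx, ENNReal.toReal_ofReal (by norm_num),
    ENNReal.toReal_add (ENNReal.add_ne_top.2 ⟨hsum' _, hsum2⟩) (hefin _),
    ENNReal.toReal_add (hsum' _) hsum2, hone, ENNReal.toReal_sum fun i _ => hprod i _]
  simp only [ENNReal.toReal_mul, hone]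

open Classical in
/-- The 4213-avoiding arrangements of `0, …, N - 1`. -/
noncomputable def avoidLists (N : ℕ) : Finset (List ℕ) :=
  {l ∈ (List.range N).permutations.toFinset | Avoids4213 l}

theorem mem_avoidLists {N : ℕ} {l : List ℕ} :
    l ∈ avoidLists N ↔ l ~ List.range N ∧ Avoids4213 l := by
  simp [avoidLists, List.mem_permutations]

theorem RunList.mem_avoidLists {j : ℕ} {l : List ℕ} (h : RunList j l) :
    l ∈ avoidLists l.length := by
  refine _root_.mem_avoidLists.2 ⟨?_, h.avoids⟩
  rw [List.perm_ext_iff_of_nodup h.nodup List.nodup_range]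
  simpa using h.mem_iff

theorem mul_newGF_one_le (x : ℝ≥0∞) :
    x * newGF x 1 ≤ ∑' N, ((avoidLists N).card : ℝ≥0∞) * x ^ N := by
  let f : {l // NewList 1 l} → Σ N, avoidLists N := fun l => ⟨l.1.length, l.1, l.2.mem_avoidLists⟩
  have hf : Function.Injective f := by
    intro l m h
    have : (f l).2.1 = (f m).2.1 := by rw [h]
    exact Subtype.ext this
  have h := ENNReal.tsum_comp_le_tsum_of_injective hf fun p => x ^ p.1
  rw [ENNReal.tsum_sigma'] at h
  rw [newGF, ← ENNReal.tsum_mul_left]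
  refine le_trans (le_of_eq (tsum_congr fun l => ?_)) (h.trans (le_of_eq (tsum_congr fun N => ?_)))
  · rw [← pow_succ', Nat.sub_add_cancel l.2.le_length]
  · simp

theorem exists_lt_card_avoidLists {K c : ℝ} (hc0 : 0 ≤ c) (hc : c < 61 / 8) :
    ∃ N, K * c ^ N < (avoidLists N).card := by
  by_contra! h
  have hsum : Summable fun N : ℕ => K * (c * (8 / 61)) ^ N :=
    (summable_geometric_of_lt_one (by positivity) (by linarith)).mul_left K
  have hx : ENNReal.ofReal (8 / 61) ≠ 0 := by simp
  have htop := mul_newGF_one_le (ENNReal.ofReal (8 / 61))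
  rw [newGF_one_eq_top, ENNReal.mul_top hx, top_le_iff] at htop
  refine hsum.tsum_ofReal_ne_top (top_le_iff.1 (htop ▸ ENNReal.tsum_le_tsum fun N => ?_))
  rw [← ENNReal.ofReal_natCast, ← ENNReal.ofReal_pow (by norm_num),
    ← ENNReal.ofReal_mul (by positivity), mul_pow, ← mul_assoc]
  exact ENNReal.ofReal_le_ofReal (mul_le_mul_of_nonneg_right (h N) (by positivity))

/-- No five entries of `l` form the pattern 54213. -/
def Avoids54213 (l : List ℕ) : Prop :=
  ∀ e a b c d, [e, a, b, c, d] <+ l → c < b → b < d → d < a → ¬ a < e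

theorem Avoids54213.map {l : List ℕ} (h : Avoids54213 l) {f : ℕ → ℕ} (hf : StrictMono f) :
    Avoids54213 (l.map f) := by
  intro e a b c d hs
  obtain ⟨m, hm, he⟩ := List.sublist_map_iff.1 hs
  match m, he with
  | [e', a', b', c', d'], he =>
    simp only [List.map_cons, List.map_nil, List.cons.injEq, and_true] at he
    obtain ⟨rfl, rfl, rfl, rfl, rfl⟩ := he
    simp only [hf.lt_iff_lt]
    exact h _ _ _ _ _ hm

/-- Merge `s` and `t` into one list, taking an entry of `s` at each `true` of the word and an entry
of `t` at each `false`. -/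
def shuffle : List Bool → List ℕ → List ℕ → List ℕ
  | [], _, _ => []
  | true :: w, s, t => s.headD 0 :: shuffle w s.tail t
  | false :: w, s, t => t.headD 0 :: shuffle w s t.tail

theorem shuffle_spec {p : ℕ} (w : List Bool) {s t : List ℕ} (hs : s.length = w.count true)
    (ht : t.length = w.count false) (hs' : ∀ x ∈ s, p ≤ x) (ht' : ∀ x ∈ t, x < p) :
    (shuffle w s t).map (fun x => decide (p ≤ x)) = w ∧
      (shuffle w s t).filter (fun x => decide (p ≤ x)) = s ∧
      (shuffle w s t).filter (fun x => !decide (p ≤ x)) = t := by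
  induction w generalizing s t with
  | nil => simp_all [shuffle]
  | cons z w ih =>
    cases z
    · cases t with
      | nil => simp at ht
      | cons y t =>
        simp only [List.forall_mem_cons] at ht'
        have := ih (s := s) (t := t) (by simpa using hs) (by simpa using ht) hs' ht'.2
        simpa [shuffle, ht'.1] using this
    · cases s with
      | nil => simp at hs
      | cons y s =>
        simp only [List.forall_mem_cons] at hs'
        have := ih (s := s) (t := t) (by simpa using hs) (by simpa using ht) hs'.2 ht'
        simpa [shuffle, hs'.1] using this

theorem perm_range_of_nodup {l : List ℕ} {n : ℕ} (h : l.Nodup) (hl : ∀ x ∈ l, x < n)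
    (hn : l.length = n) : l ~ List.range n :=
  (List.subperm_of_subset h fun x hx => List.mem_range.2 (hl x hx)).perm_of_length_le (by simp [hn])

theorem sublist_of_sublist_append_of_pairwise {x y : ℕ} {l s t : List ℕ}
    (h : x :: y :: l <+ s ++ t) (hs : s.Pairwise (· < ·)) (hyx : y < x) : y :: l <+ t := by
  obtain ⟨u, v, huv, hu, hv⟩ := List.sublist_append_iff.1 h
  match u, huv with
  | [], huv =>
    rw [List.nil_append] at huv
    exact ((List.sublist_cons_self x _).trans (huv ▸ List.Sublist.refl _)).trans hv
  | [z], huv =>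
    obtain ⟨-, rfl⟩ := List.cons_eq_cons.1 huv
    exact hv
  | z :: z' :: u, huv =>
    simp only [List.cons_append, List.cons.injEq] at huv
    obtain ⟨rfl, rfl, -⟩ := huv
    have := (hs.sublist hu)
    simp only [List.pairwise_cons, List.mem_cons, forall_eq_or_imp] at this
    omega

theorem sublist_left_of_notMem {c : ℕ} {u v s t : List ℕ} (h : u ++ c :: v <+ s ++ t)
    (hc : c ∉ t) : u <+ s := by
  obtain ⟨u', v', huv, hu, hv⟩ := List.sublist_append_iff.1 h
  rcases List.append_eq_append_iff.1 huv with ⟨r, rfl, -⟩ | ⟨r, rfl, rfl⟩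
  · exact (List.sublist_append_left _ _).trans hu
  · exact absurd (hv.subset (by simp)) hc

/-- The arrangements of `0, …, k + N - 1` consisting of `k` increasing entries followed by a
4213-avoiding list. -/
noncomputable def frontLists (k N : ℕ) : Finset (List ℕ) :=
  open Classical in
  {l ∈ (List.range (k + N)).permutations.toFinset |
    (l.take k).Pairwise (· < ·) ∧ Avoids4213 (l.drop k)}

theorem mem_frontLists {k N : ℕ} {l : List ℕ} : l ∈ frontLists k N ↔
    l ~ List.range (k + N) ∧ (l.take k).Pairwise (· < ·) ∧ Avoids4213 (l.drop k) := by
  simp [frontLists, List.mem_permutations]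

theorem count_notMem {k N : ℕ} {T : Finset ℕ} (hT : T ∈ (Finset.range (k + N)).powersetCard k) :
    (k + N).count (· ∉ T) = N := by
  obtain ⟨hT, hk⟩ := Finset.mem_powersetCard.1 hT
  rw [Nat.count_eq_card_filter_range, Finset.filter_notMem_eq_sdiff,
    Finset.card_sdiff_of_subset hT, Finset.card_range, hk, Nat.add_sub_cancel_left]

theorem choose_mul_card_avoidLists_le (k N : ℕ) :
    (k + N).choose k * (avoidLists N).card ≤ (frontLists k N).card := by
  classical
  have hcard := Finset.card_powersetCard k (Finset.range (k + N))
  rw [Finset.card_range] at hcard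
  rw [← hcard, ← Finset.card_product]
  have hinf : ∀ T : Finset ℕ, (Set.ofPred (· ∉ T)).Infinite := fun T => T.finite_toSet.infinite_compl
  refine Finset.card_le_card_of_injOn
    (fun q => q.1.sort ++ q.2.map (Nat.nth (· ∉ q.1))) ?_ ?_
  · rintro ⟨T, l⟩ hq
    obtain ⟨hT, hl⟩ := Finset.mem_product.1 hq
    obtain ⟨hl, hav⟩ := mem_avoidLists.1 hl
    have hcount := count_notMem hT
    obtain ⟨hT, hk⟩ := Finset.mem_powersetCard.1 hT
    have hlen : T.sort.length = k := by rw [Finset.length_sort, hk]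
    refine mem_frontLists.2 ⟨perm_range_of_nodup ?_ ?_ ?_, ?_, ?_⟩
    · refine List.nodup_append'.2 ⟨T.sort_nodup _, ?_, ?_⟩
      · exact (hl.nodup_iff.2 List.nodup_range).map (Nat.nth_injective (hinf T))
      · intro x hx hx'
        obtain ⟨y, -, rfl⟩ := List.mem_map.1 hx'
        exact Nat.nth_mem_of_infinite (hinf T) y ((Finset.mem_sort _).1 hx)
    · intro x hx
      rcases List.mem_append.1 hx with hx | hx
      · exact Finset.mem_range.1 (hT ((Finset.mem_sort _).1 hx))
      · obtain ⟨y, hy, rfl⟩ := List.mem_map.1 hx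
        refine Nat.nth_lt_of_lt_count ?_
        rw [hcount]
        simpa using hl.subset hy
    · simp [hk, hl.length_eq]
    · rw [List.take_left' hlen]
      exact T.sortedLT_sort.pairwise
    · rw [List.drop_left' hlen]
      exact hav.map (Nat.nth_strictMono (hinf T))
  · rintro ⟨T, l⟩ hq ⟨T', l'⟩ hq' h
    have hT := (Finset.mem_powersetCard.1 (Finset.mem_product.1 hq).1).2
    have hT' := (Finset.mem_powersetCard.1 (Finset.mem_product.1 hq').1).2
    obtain ⟨h1, h2⟩ := List.append_inj h (by simp [hT, hT'])
    obtain rfl : T = T' := by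
      rw [← T.sort_toFinset (· ≤ ·), ← T'.sort_toFinset (· ≤ ·)]
      exact congrArg List.toFinset h1
    exact Prod.ext rfl (List.map_injective_iff.2 (Nat.nth_injective (hinf T)) h2)

/-- The word of length `p` recording membership in `S`. -/
def membershipWord (p : ℕ) (S : Finset ℕ) : List Bool :=
  (List.range p).map fun i => decide (i ∈ S)

theorem length_membershipWord (p : ℕ) (S : Finset ℕ) : (membershipWord p S).length = p := by
  simp [membershipWord]

theorem count_true_membershipWord {k p : ℕ} {S : Finset ℕ}
    (hS : S ∈ (Finset.range p).powersetCard k) : (membershipWord p S).count true = k := by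
  obtain ⟨hS, hk⟩ := Finset.mem_powersetCard.1 hS
  have hS' : ((List.range p).filter fun i => decide (i ∈ S)).toFinset = S := by
    ext i
    simpa using fun hi => Finset.mem_range.1 (hS hi)
  rw [membershipWord, List.count, List.countP_map, List.countP_eq_length_filter, ← hk]
  conv_rhs => rw [← hS', List.toFinset_card_of_nodup (List.nodup_range.filter _)]
  simp [Function.comp_def]

theorem membershipWord_injOn (p : ℕ) :
    Set.InjOn (membershipWord p) {S | S ⊆ Finset.range p} := by
  intro S hS S' hS' h
  have h' : ∀ i < p, (i ∈ S ↔ i ∈ S') := by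
    simpa [membershipWord, List.map_inj_left] using h
  ext i
  by_cases hi : i < p
  · exact h' i hi
  · exact iff_of_false (fun h => hi (Finset.mem_range.1 (hS h)))
      fun h => hi (Finset.mem_range.1 (hS' h))

/-- The 54213-avoiding arrangements of `0, …, n - 1` that begin with `k + 1` increasing entries. -/
noncomputable def leadLists (k n : ℕ) : Finset (List ℕ) :=
  open Classical in
  {l ∈ (List.range n).permutations.toFinset |
    k < n ∧ (l.take (k + 1)).Pairwise (· < ·) ∧ Avoids54213 l}

theorem mem_leadLists {k n : ℕ} {l : List ℕ} : l ∈ leadLists k n ↔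
    l ~ List.range n ∧ k < n ∧ (l.take (k + 1)).Pairwise (· < ·) ∧ Avoids54213 l := by
  simp [leadLists, List.mem_permutations]

/-- Raise the entries of `l` by `w.length`, shuffle its entries in positions `1, …, k` with the
entries of `f` after the first `k`, and place the first `k` entries of `f` in front. -/
def inflate (k : ℕ) (w : List Bool) (f l : List ℕ) : List ℕ :=
  f.take k ++ ((l.map (· + w.length)).take 1 ++
    shuffle w (((l.map (· + w.length)).drop 1).take k) (f.drop k)) ++
    (l.map (· + w.length)).drop (k + 1)

theorem inflate_spec {k N n : ℕ} {w : List Bool} {f l : List ℕ} (hl : l ∈ leadLists k n)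
    (hf : f ∈ frontLists k N) (hw : w.length = k + N) (hw' : w.count true = k) :
    ∃ m s r x, l.map (· + (k + N)) = m :: s ++ r ∧ s.length = k ∧ x.length = k + N ∧
      inflate k w f l = f.take k ++ m :: x ++ r ∧
      x.map (fun y => decide (k + N ≤ y)) = w ∧
      x.filter (fun y => decide (k + N ≤ y)) = s ∧
      x.filter (fun y => !decide (k + N ≤ y)) = f.drop k := by
  obtain ⟨hperm, hn, hlead, hav⟩ := mem_leadLists.1 hl
  obtain ⟨hfperm, -, -⟩ := mem_frontLists.1 hf
  have hlen := hperm.length_eq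
  have hflen := hfperm.length_eq
  have hc := List.count_false_add_count_true w
  rw [List.length_range] at hlen hflen
  obtain ⟨m, t, rfl⟩ := List.exists_cons_of_length_pos (l := l) (by omega)
  rw [List.length_cons] at hlen
  have hs : ∀ y ∈ ((t.map (· + (k + N))).take k), k + N ≤ y := by
    intro y hy
    obtain ⟨z, -, rfl⟩ := List.mem_map.1 (List.mem_of_mem_take hy)
    omega
  have hf' : ∀ y ∈ f.drop k, y < k + N := fun y hy =>
    List.mem_range.1 (hfperm.subset (List.mem_of_mem_drop hy))
  have hslen : ((t.map (· + (k + N))).take k).length = k := by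
    rw [List.length_take, List.length_map]
    omega
  obtain ⟨h1, h2, h3⟩ := shuffle_spec w (hslen.trans hw'.symm)
    (by rw [List.length_drop]; omega) hs hf'
  refine ⟨m + (k + N), (t.map (· + (k + N))).take k, (t.map (· + (k + N))).drop k, _, ?_, hslen, ?_,
    ?_, h1, h2, h3⟩
  · simp
  · exact (List.length_map _).symm.trans ((congrArg List.length h1).trans hw)
  · simp [inflate, hw]

theorem inflate_injective {k N n : ℕ} {w w' : List Bool} {f f' l l' : List ℕ}
    (hl : l ∈ leadLists k n) (hf : f ∈ frontLists k N) (hw : w.length = k + N)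
    (hwk : w.count true = k) (hl' : l' ∈ leadLists k n) (hf' : f' ∈ frontLists k N)
    (hw' : w'.length = k + N) (hwk' : w'.count true = k)
    (h : inflate k w f l = inflate k w' f' l') : w = w' ∧ f = f' ∧ l = l' := by
  obtain ⟨m, s, r, x, h1, h2, h3, h4, rfl, rfl, h7⟩ := inflate_spec hl hf hw hwk
  obtain ⟨m', s', r', x', h1', h2', h3', h4', rfl, rfl, h7'⟩ := inflate_spec hl' hf' hw' hwk'
  have hflen := (mem_frontLists.1 hf).1.length_eq
  have hflen' := (mem_frontLists.1 hf').1.length_eq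
  rw [List.length_range] at hflen hflen'
  rw [h4, h4'] at h
  obtain ⟨h8, rfl⟩ := List.append_inj h (by simp [h3, h3', hflen, hflen'])
  obtain ⟨h9, h10⟩ := List.append_inj h8 (by simp [hflen, hflen'])
  obtain ⟨rfl, rfl⟩ := List.cons_eq_cons.1 h10
  refine ⟨rfl, ?_, List.map_injective_iff.2 (add_left_injective (k + N)) (h1.trans h1'.symm)⟩
  rw [← List.take_append_drop k f, h9, ← h7, h7', List.take_append_drop]

theorem inflate_mem {k N n : ℕ} {w : List Bool} {f l : List ℕ}
    (hl : l ∈ leadLists k n) (hf : f ∈ frontLists k N) (hw : w.length = k + N)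
    (hwk : w.count true = k) : inflate k w f l ∈ leadLists k (k + N + n) := by
  obtain ⟨m, s, r, x, hlms, hslen, hxlen, hL, -, hxs, hxf⟩ := inflate_spec hl hf hw hwk
  obtain ⟨hperm, hn, hlead, hav⟩ := mem_leadLists.1 hl
  obtain ⟨hfperm, hinc, hfav⟩ := mem_frontLists.1 hf
  have hge : ∀ y ∈ m :: s ++ r, k + N ≤ y := by
    intro y hy
    rw [← hlms] at hy
    obtain ⟨z, -, rfl⟩ := List.mem_map.1 hy
    omega
  have hlt : ∀ y ∈ f, y < k + N := fun y hy => List.mem_range.1 (hfperm.subset hy)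
  have hm : k + N ≤ m := hge m (by simp)
  have hr : ∀ y ∈ r, k + N ≤ y := fun y hy => hge y (by simp [hy])
  have ht : ∀ y ∈ f.take k, y < k + N := fun y hy => hlt y (List.mem_of_mem_take hy)
  have hbig : (inflate k w f l).filter (fun y => decide (k + N ≤ y)) = l.map (· + (k + N)) := by
    rw [hL, hlms, List.filter_append, List.filter_append, List.filter_cons, hxs,
      List.filter_eq_nil_iff.2 (by simpa using ht), List.filter_eq_self.2 (by simpa using hr)]
    simp [hm]
  have hsmall : (m :: x ++ r).filter (fun y => !decide (k + N ≤ y)) = f.drop k := by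
    rw [List.filter_append, List.filter_cons, hxf, List.filter_eq_nil_iff.2 (by simpa using hr)]
    simp [hm]
  have hlenf := hfperm.length_eq
  rw [List.length_range] at hlenf
  have htlen : (f.take k).length = k := by simp [hlenf]
  have hlead' : (m :: s).Pairwise (· < ·) := by
    have : (l.map (· + (k + N))).take (k + 1) = m :: s := by
      rw [hlms, List.take_left' (by simp [hslen])]
    rw [← this, ← List.map_take]
    exact hlead.map _ fun a b hab => Nat.add_lt_add_right hab _
  refine mem_leadLists.2 ⟨?_, by omega, ?_, ?_⟩
  · refine (List.filter_append_perm (fun y => decide (k + N ≤ y)) _).symm.trans ?_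
    rw [hbig, hL, List.append_assoc, List.filter_append, hsmall,
      List.filter_eq_self.2 (by simpa using ht), List.take_append_drop, List.range_add]
    refine List.perm_append_comm.trans (hfperm.append ?_)
    simpa [add_comm] using hperm.map (· + (k + N))
  · rw [hL, List.append_assoc, List.take_append, htlen, List.take_of_length_le (by omega)]
    simp only [Nat.add_sub_cancel_left, List.cons_append, List.take_succ_cons, List.take_zero]
    refine List.pairwise_append.2 ⟨hinc, by simp, ?_⟩
    intro a ha b hb
    rw [List.mem_singleton.1 hb]
    exact (ht a ha).trans_le hm
  · intro e a b c d hs hcb hbd hda hae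
    rcases le_or_gt (k + N) c with hc | hc
    · have := hs.filter fun y => decide (k + N ≤ y)
      rw [hbig, List.filter_eq_self.2 (by simp; omega)] at this
      exact hav.map (add_left_strictMono (a := k + N)) _ _ _ _ _ this hcb hbd hda hae
    rw [hL] at hs
    rcases le_or_gt (k + N) a with ha | ha
    · have h1 := sublist_left_of_notMem (u := [e, a, b]) hs fun h => by
        have := hr c h
        omega
      have h2 := (((List.sublist_append_left [e, a] [b]).trans h1)).filter
        fun y => decide (k + N ≤ y)
      rw [List.filter_eq_self.2 (by simp; omega), List.filter_append, List.filter_cons, hxs,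
        List.filter_eq_nil_iff.2 (by simpa using ht)] at h2
      simp only [hm, decide_true, if_true, List.nil_append] at h2
      have := hlead'.sublist h2
      simp at this
      omega
    · rw [List.append_assoc] at hs
      have h1 := (sublist_of_sublist_append_of_pairwise hs hinc hae).filter
        fun y => !decide (k + N ≤ y)
      rw [hsmall, List.filter_eq_self.2 (by simp; omega)] at h1
      exact (hfav _ _ _ _ h1 hcb hbd).not_gt hda

theorem card_leadLists_mul_le (k N n : ℕ) :
    (k + N).choose k ^ 2 * (avoidLists N).card * (leadLists k n).card ≤
      (leadLists k (k + N + n)).card := by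
  classical
  have hcard := Finset.card_powersetCard k (Finset.range (k + N))
  rw [Finset.card_range] at hcard
  calc _ = (k + N).choose k * ((k + N).choose k * (avoidLists N).card) *
        (leadLists k n).card := by ring
    _ ≤ (k + N).choose k * (frontLists k N).card * (leadLists k n).card := by
        gcongr
        exact choose_mul_card_avoidLists_le k N
    _ = (((Finset.range (k + N)).powersetCard k ×ˢ frontLists k N) ×ˢ leadLists k n).card := by
        rw [Finset.card_product, Finset.card_product, hcard]
    _ ≤ _ := by
        refine Finset.card_le_card_of_injOn
          (fun q => inflate k (membershipWord (k + N) q.1.1) q.1.2 q.2) ?_ ?_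
        · rintro ⟨⟨S, f⟩, l⟩ hq
          simp only [Finset.coe_product, Set.mem_prod, Finset.mem_coe] at hq
          exact inflate_mem hq.2 hq.1.2 (length_membershipWord _ _)
            (count_true_membershipWord hq.1.1)
        · rintro ⟨⟨S, f⟩, l⟩ hq ⟨⟨S', f'⟩, l'⟩ hq' h
          simp only [Finset.coe_product, Set.mem_prod, Finset.mem_coe] at hq hq'
          obtain ⟨h1, rfl, rfl⟩ := inflate_injective hq.2 hq.1.2 (length_membershipWord _ _)
            (count_true_membershipWord hq.1.1) hq'.2 hq'.1.2 (length_membershipWord _ _)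
            (count_true_membershipWord hq'.1.1) h
          rw [membershipWord_injOn _ (Finset.mem_powersetCard.1 hq.1.1).1
            (Finset.mem_powersetCard.1 hq'.1.1).1 h1]

theorem range_mem_leadLists {k n : ℕ} (h : k < n) : List.range n ∈ leadLists k n := by
  refine mem_leadLists.2 ⟨List.Perm.refl _, h, List.pairwise_lt_range.sublist (List.take_sublist _ _),
    fun e a b c d hs _ _ _ => ?_⟩
  have := List.pairwise_lt_range.sublist hs
  simp at this
  omega

theorem pow_le_card_leadLists (k N r m : ℕ) :
    ((k + N).choose k ^ 2 * (avoidLists N).card) ^ m ≤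
      (leadLists k (m * (k + N) + (k + 1 + r))).card := by
  induction m with
  | zero =>
    rw [pow_zero, Nat.one_le_iff_ne_zero, ← Nat.pos_iff_ne_zero, Finset.card_pos]
    exact ⟨_, range_mem_leadLists (by omega)⟩
  | succ m ih =>
    rw [pow_succ']
    refine (Nat.mul_le_mul_left _ ih).trans ((card_leadLists_mul_le k N _).trans (le_of_eq ?_))
    congr 2
    ring

theorem card_avoidLists_zero_le : (avoidLists 0).card ≤ 1 := by
  refine Finset.card_le_one.2 fun l hl l' hl' => ?_
  rw [List.perm_nil.1 (mem_avoidLists.1 hl).1, List.perm_nil.1 (mem_avoidLists.1 hl').1]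

theorem exists_pow_lt_choose_sq_mul_card :
    ∃ k N, 0 < k + N ∧
      (14.12 : ℝ) ^ (k + N) < ((k + N).choose k ^ 2 * (avoidLists N).card : ℕ) := by
  by_contra! h
  have h' : ∀ k N, (((k + N).choose k ^ 2 * (avoidLists N).card : ℕ) : ℝ) ≤ 14.12 ^ (k + N) := by
    intro k N
    rcases Nat.eq_zero_or_pos (k + N) with h0 | h0
    · obtain ⟨rfl, rfl⟩ := Nat.add_eq_zero_iff.1 h0
      simpa using card_avoidLists_zero_le
    · exact h k N h0
  set q : ℝ := 3.758 with hq
  set r : ℝ := 0.266 with hr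
  obtain ⟨N, hN⟩ := exists_lt_card_avoidLists (K := ((1 - r) / (1 - q * r)) ^ 2)
    (c := (q * (1 - r)) ^ 2) (by positivity) (by norm_num [hq, hr])
  set s := √((avoidLists N).card : ℝ) with hs
  have hs0 : 0 ≤ s := Real.sqrt_nonneg _
  have hs2 : s ^ 2 = (avoidLists N).card := Real.sq_sqrt (Nat.cast_nonneg _)
  have hr1 : ‖r‖ < 1 := by norm_num [hr]
  have hqr : q * r < 1 := by norm_num [hq, hr]
  have hterm : ∀ k : ℕ, ((k + N).choose N * r ^ k) * s ≤ q ^ N * (q * r) ^ k := by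
    intro k
    have h1 : ((k + N).choose N : ℝ) * s ≤ q ^ (k + N) := by
      refine le_of_sq_le_sq ?_ (by positivity)
      rw [mul_pow, hs2, ← pow_mul, mul_comm (k + N), pow_mul]
      have h2 := h' k N
      rw [Nat.choose_symm_add] at h2
      push_cast at h2
      refine h2.trans (pow_le_pow_left₀ (by norm_num) (by norm_num [hq]) _)
    calc _ = (((k + N).choose N : ℝ) * s) * r ^ k := by ring
      _ ≤ q ^ (k + N) * r ^ k := by gcongr
      _ = _ := by rw [mul_pow, pow_add]; ring
  have hsum := Summable.tsum_le_tsum hterm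
    ((summable_choose_mul_geometric_of_norm_lt_one N hr1).mul_right s)
    ((summable_geometric_of_lt_one (by positivity) hqr).mul_left (q ^ N))
  rw [tsum_mul_right, tsum_choose_mul_geometric_of_norm_lt_one N hr1, tsum_mul_left,
    tsum_geometric_of_lt_one (by positivity) hqr] at hsum
  have h1r : 0 < 1 - r := by norm_num [hr]
  have hle : s ≤ (1 - r) / (1 - q * r) * (q * (1 - r)) ^ N := by
    rw [one_div, inv_mul_le_iff₀ (by positivity)] at hsum
    refine hsum.trans (le_of_eq ?_)
    rw [mul_pow, pow_succ, div_eq_mul_inv]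
    ring
  refine hN.not_ge ?_
  rw [← hs2]
  refine (pow_le_pow_left₀ hs0 hle 2).trans (le_of_eq ?_)
  rw [mul_pow, ← pow_mul, ← pow_mul, mul_comm N]

/-- The permutation `i ↦ n - 1 - l[i]` attached to an arrangement `l` of `0, …, n - 1`. -/
noncomputable def revPerm {n : ℕ} (l : List ℕ) (h : l ~ List.range n) : Equiv.Perm (Fin n) :=
  have hlen : l.length = n := h.length_eq.trans List.length_range
  Equiv.ofBijective
    (fun i => Fin.rev ⟨l[i.1]'(hlen ▸ i.2), List.mem_range.1 (h.subset (List.getElem_mem _))⟩)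
    (Finite.injective_iff_bijective.1 fun i j hij => by
      have := Fin.mk.inj_iff.1 (Fin.rev_injective hij)
      exact Fin.ext (((h.nodup_iff.2 List.nodup_range).getElem_inj_iff).1 this))

theorem revPerm_apply {n : ℕ} {l : List ℕ} (h : l ~ List.range n) (i : Fin n) :
    revPerm l h i = Fin.rev ⟨l[i.1]'((h.length_eq.trans List.length_range) ▸ i.2),
      List.mem_range.1 (h.subset (List.getElem_mem _))⟩ :=
  rfl

theorem Avoids54213.revPerm {n : ℕ} {l : List ℕ} (hl : Avoids54213 l) (h : l ~ List.range n) :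
    PermAvoids (revPerm l h) pat12453 := by
  rintro ⟨f, hf, hp⟩
  have hlen : l.length = n := h.length_eq.trans List.length_range
  have hsub : List.ofFn (fun i => l[(f i).1]'(hlen ▸ (f i).2)) <+ l := by
    refine List.sublist_iff_exists_fin_orderEmbedding_get_eq.2
      ⟨OrderEmbedding.ofStrictMono (fun i => ⟨f (i.cast (by simp)), (f _).2.trans_eq hlen.symm⟩) ?_, ?_⟩
    · intro i j hij
      exact hf hij
    · intro i
      rw [List.get_eq_getElem, List.getElem_ofFn]
      rfl
  have hlt : ∀ a b : Fin 5, l[(f b).1]'(hlen ▸ (f b).2) < l[(f a).1]'(hlen ▸ (f a).2) ↔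
      pat12453 a < pat12453 b := by
    intro a b
    rw [← hp, revPerm_apply, revPerm_apply, Fin.rev_lt_rev, Fin.mk_lt_mk]
  simp only [List.ofFn_succ, List.ofFn_zero] at hsub
  exact hl _ _ _ _ _ hsub ((hlt 2 3).2 (by decide)) ((hlt 4 2).2 (by decide))
    ((hlt 1 4).2 (by decide)) ((hlt 0 1).2 (by decide))

theorem card_leadLists_le_avoiders (k n : ℕ) :
    (leadLists k n).card ≤ avoiders n pat12453 := by
  rw [← Nat.card_eq_finsetCard, avoiders]
  refine Nat.card_le_card_of_injective (fun l : leadLists k n =>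
    ⟨revPerm l.1 (mem_leadLists.1 l.2).1, (mem_leadLists.1 l.2).2.2.2.revPerm _⟩) ?_
  rintro ⟨l, hl⟩ ⟨l', hl'⟩ h
  have h1 := (mem_leadLists.1 hl).1
  have h1' := (mem_leadLists.1 hl').1
  refine Subtype.ext (List.ext_getElem (h1.length_eq.trans h1'.length_eq.symm) fun i hi hi' => ?_)
  have h2 := DFunLike.congr_fun (Subtype.mk.inj h) ⟨i, by
    rwa [h1.length_eq, List.length_range] at hi⟩
  simpa [revPerm_apply] using h2

/-- There is a positive integer `N` such that for all `n ≥ N`,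
`S_n(12453) > 14.12^n`. -/
theorem stanley_wilf_12453_lower :
    ∃ N : ℕ, 0 < N ∧ ∀ n : ℕ, N ≤ n → (14.12 : ℝ) ^ n < (avoiders n pat12453 : ℝ) := by
  obtain ⟨k, N, hp, hA⟩ := exists_pow_lt_choose_sq_mul_card
  set A := (k + N).choose k ^ 2 * (avoidLists N).card with hA'
  set p := k + N
  have hpow : (0 : ℝ) < 14.12 ^ p := by positivity
  obtain ⟨M, hM⟩ := pow_unbounded_of_one_lt ((14.12 : ℝ) ^ (k + 1 + p)) ((one_lt_div hpow).2 hA)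
  refine ⟨M * p + (k + 1), by omega, fun n hn => ?_⟩
  set m := (n - (k + 1)) / p
  have hn' : n = m * p + (k + 1 + (n - (k + 1)) % p) := by
    have : m * p + (n - (k + 1)) % p = n - (k + 1) := Nat.div_add_mod' _ _
    omega
  have hMm : M ≤ m := (Nat.le_div_iff_mul_le hp).2 (by omega)
  have hcard : (A : ℝ) ^ m ≤ avoiders n pat12453 := by
    have h := pow_le_card_leadLists k N ((n - (k + 1)) % p) m
    rw [← hn'] at h
    exact_mod_cast h.trans (card_leadLists_le_avoiders k n)
  have hmod := Nat.mod_lt (n - (k + 1)) hp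
  calc (14.12 : ℝ) ^ n ≤ 14.12 ^ (k + 1 + p + p * m) := by
        refine pow_le_pow_right₀ (by norm_num) ?_
        rw [mul_comm p]
        omega
    _ = 14.12 ^ (k + 1 + p) * (14.12 ^ p) ^ m := by rw [pow_add, pow_mul]
    _ < (A / 14.12 ^ p) ^ m * (14.12 ^ p) ^ m := by
        gcongr
        exact hM.trans_le (pow_le_pow_right₀ ((one_lt_div hpow).2 hA).le hMm)
    _ = (A : ℝ) ^ m := by rw [← mul_pow, div_mul_cancel₀ _ hpow.ne']
    _ ≤ _ := hcard
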